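/- Let k be a field of characteristic 0, k' a finite extension of k, and K = k'((s)). For every b ∈ K and every pair of triples p̃ = (ỹ₁, ỹ₂, ỹ₃), p̂ = (ŷ₁, ŷ₂, ŷ₃) of units of K[t]/(t³) with ỹᵢ ≡ ŷᵢ mod t² for i = 1, 2, 3, one has Ω(τ_{0,b}(p̃), p̂) = Ω(p̃, p̂), where τ_{0,b} is applied entrywise. (In other words, Ω is unchanged when its first argument is moved by an automorphism that induces the identity modulo (t²); this shows that the 1-form ω does not depend on the choice of lifting of the identification modulo t².) -/

import Mathlib

noncomputable section

/-- The formal derivative `d/ds` on the field of Laurent series `k'((s))`. -/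
def lsDeriv {k' : Type*} [Field k'] (f : LaurentSeries k') : LaurentSeries k' where
  coeff n := (n + 1 : ℤ) • f.coeff (n + 1)
  isPWO_support' := by
    refine Set.IsPWO.mono (Set.IsPWO.image_of_monotoneOn (f.isPWO_support)
      (fun x _ y _ h => by simpa using h : MonotoneOn (fun m : ℤ => m - 1) f.support)) ?_
    intro n hn
    refine ⟨n + 1, ?_, by ring⟩
    simp only [Function.mem_support, ne_eq] at hn ⊢
    intro h
    exact hn (by simp [HahnSeries.support, h] at hn ⊢)

/-- The truncated polynomial ring `K[t]/(t³)`. -/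
abbrev T3 (K : Type*) [Field K] := Polynomial K ⧸ Ideal.span {(Polynomial.X : Polynomial K) ^ 3}

/-- The class of `t` in `K[t]/(t³)`. -/
def tE (K : Type*) [Field K] : T3 K := Ideal.Quotient.mk _ Polynomial.X

/-- The constant `x` viewed in `K[t]/(t³)`. -/
def cE {K : Type*} [Field K] (x : K) : T3 K := algebraMap K (T3 K) x

/-- The truncated exponential `exp(u) = 1 + u + u²/2` on `K[t]/(t³)`, well defined in
characteristic zero for `u` in the ideal `(t)`. -/
def expE {K : Type*} [Field K] (u : T3 K) : T3 K := 1 + u + cE (2⁻¹ : K) * u ^ 2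

/-- The element `α₀ · exp(α₁ t + α₂ t²)` of `K[t]/(t³)`; every unit of `K[t]/(t³)` has a
unique such exponential decomposition with `α₀ ∈ K^×`, `α₁, α₂ ∈ K`. -/
def unitE {K : Type*} [Field K] (α₀ α₁ α₂ : K) : T3 K :=
  cE α₀ * expE (cE α₁ * tE K + cE α₂ * tE K ^ 2)

/-- The canonical expression `Ω(p̃, p̂) ∈ K` of the paper (the canonical 1-form is
`Ω(p̃,p̂)·ds`), evaluated via the exponential parameters `(a0 i, a1 i, x2 i)` of the entries
of `p̃` and `(a0 i, a1 i, y2 i)` of the entries of `p̂` (congruent mod `t²`, so the parameters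
`a0`, `a1` are shared); `D` is the derivative of `K`:
`Ω(p̃, p̂) = Σ_{σ∈S₃} sgn(σ)·a1(σ1)·(x2(σ3) − y2(σ3))·(D(a0(σ2))/a0(σ2))`. -/
def Omega {K : Type*} [Field K] (D : K → K) (a0 a1 x2 y2 : Fin 3 → K) : K :=
  ∑ σ : Equiv.Perm (Fin 3),
    (Equiv.Perm.sign σ : ℤ) •
      (a1 (σ 0) * ((x2 (σ 2) - y2 (σ 2)) * (D (a0 (σ 1)) / a0 (σ 1))))

/-- The map `τ_{0,b}` of `K[t]/(t³)`, described by its value on the element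
`c₀ + c₁ t + c₂ t²`, where `D` is the derivative `d/ds` of `K = k'((s))`:
`τ_{0,b}(c₀ + c₁t + c₂t²) = c₀ + c₁t + (c₂ + c₀′b)t²`; it is the truncation of the
continuous `k[[t]]`-automorphism of `K[[t]]` sending `s` to `s + bt²`, and induces the
identity modulo `(t²)`. -/
def tau0E {K : Type*} [Field K] (D : K → K) (b c0 c1 c2 : K) : T3 K :=
  cE c0 + cE c1 * tE K + cE (c2 + D c0 * b) * tE K ^ 2

theorem tE_pow_three (K : Type*) [Field K] : tE K ^ 3 = 0 := by
  rw [tE, ← map_pow, Ideal.Quotient.eq_zero_iff_mem]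
  exact Ideal.mem_span_singleton_self _

/-- Elements of `K[t]/(t³)` are determined by their three coefficients. -/
theorem cE_coeff_ext {K : Type*} [Field K] {x y z x' y' z' : K}
    (h : cE x + cE y * tE K + cE z * tE K ^ 2 = cE x' + cE y' * tE K + cE z' * tE K ^ 2) :
    x = x' ∧ y = y' ∧ z = z' := by
  have hmk (u v w : K) : cE u + cE v * tE K + cE w * tE K ^ 2 =
      Ideal.Quotient.mk _ (Polynomial.C u + Polynomial.C v * Polynomial.X
        + Polynomial.C w * Polynomial.X ^ 2) := by
    simp only [map_add, map_mul, map_pow]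
    rfl
  rw [hmk, hmk, Ideal.Quotient.eq, Ideal.mem_span_singleton, Polynomial.X_pow_dvd_iff] at h
  refine ⟨?_, ?_, ?_⟩
  · simpa [Polynomial.coeff_X, Polynomial.coeff_X_pow, sub_eq_zero] using h 0 (by norm_num)
  · simpa [Polynomial.coeff_X, Polynomial.coeff_X_pow, Polynomial.coeff_C, sub_eq_zero]
      using h 1 (by norm_num)
  · simpa [Polynomial.coeff_X, Polynomial.coeff_X_pow, Polynomial.coeff_C, sub_eq_zero]
      using h 2 (by norm_num)

theorem unitE_eq {K : Type*} [Field K] (α₀ α₁ α₂ : K) :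
    unitE α₀ α₁ α₂ =
      cE α₀ + cE (α₀ * α₁) * tE K + cE (α₀ * (α₂ + 2⁻¹ * α₁ ^ 2)) * tE K ^ 2 := by
  have ht := tE_pow_three K
  simp only [unitE, expE, cE, map_add, map_mul, map_pow]
  linear_combination (algebraMap K (T3 K) α₀ * algebraMap K (T3 K) 2⁻¹ *
    (2 * algebraMap K (T3 K) α₁ * algebraMap K (T3 K) α₂
      + algebraMap K (T3 K) α₂ ^ 2 * tE K)) * ht

/-- The map `τ_{0,b}` shifts the second-order exponential parameter by `b · α₀′/α₀`. -/
theorem eq_add_of_tau0E_eq_unitE {K : Type*} [Field K] {D : K → K}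
    {b α₀ α₁ α₂ β₂ c₀ c₁ c₂ : K} (h₀ : α₀ ≠ 0)
    (hc : cE c₀ + cE c₁ * tE K + cE c₂ * tE K ^ 2 = unitE α₀ α₁ α₂)
    (hτ : tau0E D b c₀ c₁ c₂ = unitE α₀ α₁ β₂) :
    β₂ = α₂ + b * (D α₀ / α₀) := by
  rw [unitE_eq] at hc hτ
  obtain ⟨rfl, -, h₂⟩ := cE_coeff_ext hc
  obtain ⟨-, -, h₂'⟩ := cE_coeff_ext hτ
  field_simp
  linear_combination h₂ - h₂'

/-- `Ω` is unchanged when the second-order parameters move along the logarithmic derivatives. -/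
theorem Omega_add_mul_logDeriv {K : Type*} [Field K] (D : K → K) (b : K)
    (a0 a1 x2 y2 : Fin 3 → K) :
    Omega D a0 a1 (fun i => x2 i + b * (D (a0 i) / a0 i)) y2 = Omega D a0 a1 x2 y2 := by
  rw [Omega, Omega, ← sub_eq_zero, ← Finset.sum_sub_distrib]
  refine Finset.sum_involution (fun σ _ => σ * Equiv.swap 1 2) ?_ ?_ ?_ ?_
  · intro σ _
    have e0 : Equiv.swap (1 : Fin 3) 2 0 = 0 := by decide
    simp only [Equiv.Perm.sign_mul, Equiv.Perm.mul_apply, e0,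
      Equiv.swap_apply_left, Equiv.swap_apply_right,
      Equiv.Perm.sign_swap (by decide : (1 : Fin 3) ≠ 2), zsmul_eq_mul]
    push_cast
    ring
  · intro σ _ _ h
    exact absurd (mul_eq_left.mp h) (by decide)
  · simp
  · intro σ _
    simp [mul_assoc]

/-- Let `k` be a field of characteristic `0`, `k'` a finite extension of `k`,
and `K = k'((s))`.  For every `b ∈ K` and every pair of triples `p̃ = (ỹ₁,ỹ₂,ỹ₃)`,
`p̂ = (ŷ₁,ŷ₂,ŷ₃)` of units of `K[t]/(t³)` with `ỹᵢ ≡ ŷᵢ mod t²` — encoded by the shared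
exponential parameters `a0 i ∈ K^×`, `a1 i` and second-order parameters `ta2 i` (for `p̃`)
and `ha2 i` (for `p̂`), the entries of `p̃` being `tc0 i + tc1 i·t + tc2 i·t²` — one has
`Ω(τ_{0,b}(p̃), p̂) = Ω(p̃, p̂)`, where `τ_{0,b}` is applied entrywise and the exponential
parameters of the image triple `τ_{0,b}(p̃)` are `a0 i`, `a1 i`, `tb2 i` (it is congruent to
`p̃` mod `t²` since `τ_{0,b}` induces the identity modulo `(t²)`). -/
theorem statement_3 {k : Type*} [Field k] [CharZero k] {k' : Type*} [Field k']
    [Algebra k k'] [FiniteDimensional k k']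
    (b : LaurentSeries k')
    (a0 a1 ta2 ha2 : Fin 3 → LaurentSeries k') (h0 : ∀ i, a0 i ≠ 0)
    (tc0 tc1 tc2 : Fin 3 → LaurentSeries k')
    (htc : ∀ i, cE (tc0 i) + cE (tc1 i) * tE (LaurentSeries k')
        + cE (tc2 i) * tE (LaurentSeries k') ^ 2 = unitE (a0 i) (a1 i) (ta2 i))
    (tb2 : Fin 3 → LaurentSeries k')
    (htau : ∀ i, tau0E lsDeriv b (tc0 i) (tc1 i) (tc2 i)
        = unitE (a0 i) (a1 i) (tb2 i)) :
    Omega lsDeriv a0 a1 tb2 ha2 = Omega lsDeriv a0 a1 ta2 ha2 := by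
  rw [funext fun i => eq_add_of_tau0E_eq_unitE (h0 i) (htc i) (htau i)]
  exact Omega_add_mul_logDeriv lsDeriv b a0 a1 ta2 ha2

end
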